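/- arXiv:math/0612777 — 3 statements merged into one kernel-verified Lean document; each statement's English description precedes it below -/
import Mathlib

section
/- Let p be an interior point of N and let U ⊆ ℝ^d be an open neighborhood of p. Let F be a family of functions f : ℝ^d → ℝ, each bounded on N and three times continuously differentiable on U, such that for some B < ∞ one has sup_{f∈F} sup_{x∈N} |f(x)| ≤ B and sup_{f∈F} sup_{x∈U} |∂^α f(x)| ≤ B for every multi-index α with 1 ≤ |α| ≤ 3. Then there exist a constant C < ∞ and h₀ > 0 such that for all 0 < h < h₀, sup_{f∈F} |Δ_h f(p) − (1/|N|) Δf(p)| ≤ C h. -/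
open MeasureTheory Real Filter
open scoped Topology

/-- The Gaussian kernel `K(u) = (4π)^{-d/2} e^{-‖u‖²/4}` on `ℝ^d`. -/
noncomputable def gaussK (d : ℕ) (u : EuclideanSpace ℝ (Fin d)) : ℝ :=
  (4 * π) ^ (-(d : ℝ) / 2) * Real.exp (-‖u‖ ^ 2 / 4)

/-- The Euclidean Laplacian `Δf(p) = ∑ᵢ ∂²f/∂xᵢ²(p)`. -/
noncomputable def eucLap (d : ℕ) (f : EuclideanSpace ℝ (Fin d) → ℝ)
    (p : EuclideanSpace ℝ (Fin d)) : ℝ :=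
  ∑ i : Fin d,
    iteratedFDeriv ℝ 2 f p ![EuclideanSpace.single i 1, EuclideanSpace.single i 1]

/-- The averaging kernel operator
`Δ_h f(p) = h^{-(d+2)} E[K((p-X)/h)(f(X)-f(p))]`, where `X` is uniform on `N`. -/
noncomputable def avgLap (d : ℕ) (N : Set (EuclideanSpace ℝ (Fin d)))
    (f : EuclideanSpace ℝ (Fin d) → ℝ) (h : ℝ) (p : EuclideanSpace ℝ (Fin d)) : ℝ :=
  (h ^ (d + 2))⁻¹ * (((volume N).toReal)⁻¹ *
    ∫ x in N, gaussK d (h⁻¹ • (p - x)) * (f x - f p))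


section Taylor

variable {E G : Type*} [NormedAddCommGroup E] [NormedSpace ℝ E]
  [NormedAddCommGroup G] [NormedSpace ℝ G]

/-- Mean value inequality for a function vanishing at `p` whose derivative is bounded by a power
of the distance to `p`. -/
lemma norm_le_mul_norm_sub_pow_of_hasFDerivAt {g : E → G} {g' : E → E →L[ℝ] G} {p : E} {r C : ℝ}
    {k : ℕ} (hC : 0 ≤ C) (hg : ∀ y ∈ Metric.ball p r, HasFDerivAt g (g' y) y)
    (hb : ∀ y ∈ Metric.ball p r, ‖g' y‖ ≤ C * ‖y - p‖ ^ k) (hp : g p = 0)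
    {x : E} (hx : x ∈ Metric.ball p r) : ‖g x‖ ≤ C * ‖x - p‖ ^ (k + 1) := by
  have hsub : Metric.closedBall p ‖x - p‖ ⊆ Metric.ball p r :=
    Metric.closedBall_subset_ball (by simpa [dist_eq_norm] using hx)
  have key := Convex.norm_image_sub_le_of_norm_hasFDerivWithin_le (f := g) (f' := g')
    (C := C * ‖x - p‖ ^ k) (s := Metric.closedBall p ‖x - p‖) (x := p) (y := x)
    (fun y hy => (hg y (hsub hy)).hasFDerivWithinAt)
    (fun y hy => (hb y (hsub hy)).trans (by
      have : ‖y - p‖ ≤ ‖x - p‖ := by simpa [dist_eq_norm] using hy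
      gcongr))
    (convex_closedBall _ _) (by simp) (by simp [dist_eq_norm])
  rw [hp, sub_zero] at key
  calc ‖g x‖ ≤ C * ‖x - p‖ ^ k * ‖x - p‖ := key
    _ = C * ‖x - p‖ ^ (k + 1) := by ring

/-- Second-order Taylor expansion on a ball, with a cubic remainder. -/
lemma ContDiffOn.norm_taylor_two_sub_le {f : E → ℝ} {p : E} {r B : ℝ} (hB : 0 ≤ B)
    (hf : ContDiffOn ℝ 3 f (Metric.ball p r))
    (hb : ∀ y ∈ Metric.ball p r, ‖iteratedFDeriv ℝ 3 f y‖ ≤ B)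
    {x : E} (hx : x ∈ Metric.ball p r) :
    |f x - f p - fderiv ℝ f p (x - p) - 2⁻¹ * fderiv ℝ (fderiv ℝ f) p (x - p) (x - p)|
      ≤ B * ‖x - p‖ ^ 3 := by
  have hp : p ∈ Metric.ball p r :=
    Metric.mem_ball_self (dist_nonneg.trans_lt (Metric.mem_ball.1 hx))
  have hat : ∀ y ∈ Metric.ball p r, ContDiffAt ℝ 3 f y := fun y hy =>
    hf.contDiffAt (Metric.isOpen_ball.mem_nhds hy)
  have hat1 : ∀ y ∈ Metric.ball p r, ContDiffAt ℝ 2 (fderiv ℝ f) y := fun y hy =>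
    (hat y hy).fderiv_right (by norm_num)
  have hat2 : ∀ y ∈ Metric.ball p r, ContDiffAt ℝ 1 (fderiv ℝ (fderiv ℝ f)) y := fun y hy =>
    (hat1 y hy).fderiv_right (by norm_num)
  set D2 := fderiv ℝ (fderiv ℝ f) p with hD2
  have hsymm : ∀ v w, D2 v w = D2 w v :=
    ((hat p hp).isSymmSndFDerivAt (by simp; norm_num)).eq
  have h2 : ∀ y ∈ Metric.ball p r, ‖fderiv ℝ (fderiv ℝ f) y - D2‖ ≤ B * ‖y - p‖ ^ (0 + 1) := by
    intro y hy
    refine norm_le_mul_norm_sub_pow_of_hasFDerivAt (r := r)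
      (g := fun y => fderiv ℝ (fderiv ℝ f) y - D2)
      (g' := fun y => fderiv ℝ (fderiv ℝ (fderiv ℝ f)) y) hB ?_ ?_ (by simp [hD2]) hy
    · intro z hz
      exact (((hat2 z hz).differentiableAt (by norm_num)).hasFDerivAt).sub_const _
    · intro z hz
      rw [pow_zero, mul_one]
      refine le_of_eq_of_le ?_ (hb z hz)
      exact (norm_iteratedFDeriv_one (𝕜 := ℝ) (x := z) (fderiv ℝ (fderiv ℝ f))).symm.trans
        (norm_iteratedFDeriv_fderiv.trans norm_iteratedFDeriv_fderiv)
  have h1 : ∀ y ∈ Metric.ball p r,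
      ‖fderiv ℝ f y - fderiv ℝ f p - D2 (y - p)‖ ≤ B * ‖y - p‖ ^ (0 + 1 + 1) := by
    intro y hy
    refine norm_le_mul_norm_sub_pow_of_hasFDerivAt (r := r)
      (g := fun y => fderiv ℝ f y - fderiv ℝ f p - D2 (y - p))
      (g' := fun y => fderiv ℝ (fderiv ℝ f) y - D2) hB ?_ h2 (by simp) hy
    intro z hz
    have := ((((hat1 z hz).differentiableAt (by norm_num)).hasFDerivAt).sub_const
      (fderiv ℝ f p)).sub (D2.hasFDerivAt.comp z ((hasFDerivAt_id z).sub_const p))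
    exact this.congr_fderiv (by ext; simp)
  refine norm_le_mul_norm_sub_pow_of_hasFDerivAt (r := r) (k := 2)
      (g := fun y => f y - f p - fderiv ℝ f p (y - p) - 2⁻¹ * D2 (y - p) (y - p))
      (g' := fun y => fderiv ℝ f y - fderiv ℝ f p - D2 (y - p)) hB ?_ h1 (by simp) hx
  intro z hz
  have hid := (hasFDerivAt_id (𝕜 := ℝ) z).sub_const p
  have hq := (D2.hasFDerivAt.comp z hid).clm_apply hid
  have hl := (fderiv ℝ f p).hasFDerivAt.comp z hid
  have := (((((hat z hz).differentiableAt (by norm_num)).hasFDerivAt).sub_const (f p)).sub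
    hl).sub (hq.const_mul (2⁻¹ : ℝ))
  refine this.congr_fderiv ?_
  ext v
  have h := hsymm v (z - p)
  simp only [map_sub, sub_apply] at h
  simp
  linarith

end Taylor

section GaussianMoments

open ProbabilityTheory

variable {d : ℕ}

lemma gaussK_nonneg (u : EuclideanSpace ℝ (Fin d)) : 0 ≤ gaussK d u := by
  unfold gaussK; positivity

lemma continuous_gaussK : Continuous (gaussK d) := by
  unfold gaussK; fun_prop

lemma gaussK_eq_prod (u : EuclideanSpace ℝ (Fin d)) :
    gaussK d u = ∏ k, gaussianPDFReal 0 2 (u k) := by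
  have hc : (√(4 * π))⁻¹ = (4 * π) ^ (-(1 : ℝ) / 2) := by
    rw [Real.sqrt_eq_rpow, ← Real.rpow_neg (by positivity)]
    norm_num
  simp only [gaussianPDFReal, gaussK, Finset.prod_mul_distrib, ← Real.exp_sum,
    EuclideanSpace.norm_sq_eq, Finset.prod_const, Finset.card_univ, Fintype.card_fin]
  congr 1
  · have : (2 * π * ((2 : NNReal) : ℝ)) = 4 * π := by push_cast; ring
    rw [this, hc, ← Real.rpow_natCast, ← Real.rpow_mul (by positivity)]
    congr 1; ring
  · congr 1
    rw [neg_div, Finset.sum_div, ← Finset.sum_neg_distrib]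
    refine Finset.sum_congr rfl fun k _ => ?_
    simp only [Real.norm_eq_abs, sq_abs, sub_zero]
    push_cast; ring

lemma integrable_gaussK_mul_norm_pow (n : ℕ) :
    Integrable fun u : EuclideanSpace ℝ (Fin d) => gaussK d u * ‖u‖ ^ n := by
  have hexp : Integrable fun u : EuclideanSpace ℝ (Fin d) => rexp (-(1 / 8) * ‖u‖ ^ 2) := by
    refine Integrable.of_integral_ne_zero ?_
    rw [GaussianFourier.integral_rexp_neg_mul_sq_norm (by norm_num)]
    positivity
  refine (hexp.const_mul
    ((4 * π) ^ (-(d : ℝ) / 2) * (1 + 8 ^ n * n.factorial))).mono'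
    ((continuous_gaussK.mul (by fun_prop)).aestronglyMeasurable) (ae_of_all _ fun u => ?_)
  rw [Real.norm_of_nonneg (mul_nonneg (gaussK_nonneg u) (by positivity))]
  unfold gaussK
  have hn : ‖u‖ ^ n ≤ (1 + 8 ^ n * n.factorial) * rexp (‖u‖ ^ 2 / 8) := by
    have h1 := Real.pow_div_factorial_le_exp (‖u‖ ^ 2 / 8) (by positivity) n
    rw [div_pow, div_div, div_le_iff₀ (by positivity)] at h1
    have h2 : (1 : ℝ) ≤ rexp (‖u‖ ^ 2 / 8) := Real.one_le_exp (by positivity)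
    have h3 : ‖u‖ ^ n ≤ 1 + (‖u‖ ^ 2) ^ n := by
      rw [← pow_mul, mul_comm 2 n, pow_mul]
      nlinarith [sq_nonneg (‖u‖ ^ n - 1)]
    linarith
  have he : rexp (-‖u‖ ^ 2 / 4) * rexp (‖u‖ ^ 2 / 8) = rexp (-(1 / 8) * ‖u‖ ^ 2) := by
    rw [← Real.exp_add]; congr 1; ring
  calc (4 * π) ^ (-(d : ℝ) / 2) * rexp (-‖u‖ ^ 2 / 4) * ‖u‖ ^ n
      ≤ (4 * π) ^ (-(d : ℝ) / 2) * rexp (-‖u‖ ^ 2 / 4) *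
          ((1 + 8 ^ n * n.factorial) * rexp (‖u‖ ^ 2 / 8)) := by gcongr
    _ = _ := by rw [← he]; ring

lemma integrable_gaussK_mul {g : EuclideanSpace ℝ (Fin d) → ℝ} (hg : Continuous g) {A : ℝ} {n : ℕ}
    (hb : ∀ u, |g u| ≤ A * ‖u‖ ^ n) : Integrable fun u => gaussK d u * g u := by
  refine ((integrable_gaussK_mul_norm_pow (d := d) n).const_mul A).mono'
    ((continuous_gaussK.mul hg).aestronglyMeasurable) (ae_of_all _ fun u => ?_)
  rw [norm_mul, Real.norm_of_nonneg (gaussK_nonneg u), Real.norm_eq_abs, mul_left_comm]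
  exact mul_le_mul_of_nonneg_left (hb u) (gaussK_nonneg u)

lemma integral_gaussianPDFReal_mul_id : ∫ t, gaussianPDFReal 0 2 t * t = 0 := by
  have h := integral_id_gaussianReal (μ := 0) (v := 2)
  rw [integral_gaussianReal_eq_integral_smul (by norm_num)] at h
  simpa using h

lemma integral_gaussianPDFReal_mul_sq : ∫ t, gaussianPDFReal 0 2 t * (t * t) = 2 := by
  have h := variance_id_gaussianReal (μ := 0) (v := 2)
  rw [variance_of_integral_eq_zero (by fun_prop) (by simp),
    integral_gaussianReal_eq_integral_smul (by norm_num)] at h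
  simpa [sq] using h

lemma integral_gaussK_mul_coord_mul_coord (i j : Fin d) :
    ∫ u, gaussK d u * (u i * u j) = if i = j then 2 else 0 := by
  have hprod : ∀ u : EuclideanSpace ℝ (Fin d), gaussK d u * (u i * u j) =
      ∏ k, gaussianPDFReal 0 2 (u k) * ((if k = i then u k else 1) * (if k = j then u k else 1)) := by
    intro u
    rw [gaussK_eq_prod, Finset.prod_mul_distrib, Finset.prod_mul_distrib]
    simp
  simp_rw [hprod]
  rw [← (PiLp.volume_preserving_toLp (Fin d)).integral_comp
    (MeasurableEquiv.toLp 2 (Fin d → ℝ)).measurableEmbedding]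
  rw [integral_fintype_prod_volume_eq_prod (fun k t => gaussianPDFReal 0 2 t *
    ((if k = i then t else 1) * (if k = j then t else 1)))]
  split_ifs with hij
  · subst hij
    rw [Finset.prod_eq_single i]
    · simpa using integral_gaussianPDFReal_mul_sq
    · intro k _ hk
      simpa [hk] using integral_gaussianPDFReal_eq_one 0 (v := 2) (by norm_num)
    · simp
  · refine Finset.prod_eq_zero (Finset.mem_univ i) ?_
    simpa [hij] using integral_gaussianPDFReal_mul_id

lemma integral_gaussK_mul_clm (L : EuclideanSpace ℝ (Fin d) →L[ℝ] ℝ) :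
    ∫ u, gaussK d u * L u = 0 := by
  have h := integral_neg_eq_self (fun u => gaussK d u * L u) volume
  have h2 : ∀ u, gaussK d (-u) * L (-u) = -(gaussK d u * L u) := fun u => by simp [gaussK]
  simp_rw [h2, integral_neg] at h
  linarith

lemma integral_gaussK_mul_bilin
    (Q : EuclideanSpace ℝ (Fin d) →L[ℝ] EuclideanSpace ℝ (Fin d) →L[ℝ] ℝ) :
    ∫ u, gaussK d u * Q u u =
      2 * ∑ i, Q (EuclideanSpace.single i 1) (EuclideanSpace.single i 1) := by
  have hexp : ∀ u : EuclideanSpace ℝ (Fin d), gaussK d u * Q u u = ∑ i, ∑ j,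
      (gaussK d u * (u i * u j)) * Q (EuclideanSpace.single i 1) (EuclideanSpace.single j 1) := by
    intro u
    have hu : u = ∑ i, u i • EuclideanSpace.single i (1 : ℝ) := by
      simpa using ((EuclideanSpace.basisFun (Fin d) ℝ).sum_repr u).symm
    have hQ : Q u u = Q (∑ i, u i • EuclideanSpace.single i (1 : ℝ))
        (∑ i, u i • EuclideanSpace.single i (1 : ℝ)) := by rw [← hu]
    rw [hQ]
    simp only [map_sum, map_smul, sum_apply, smul_apply,
      smul_eq_mul, Finset.mul_sum]
    rw [Finset.sum_comm]
    refine Finset.sum_congr rfl fun i _ => ?_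
    refine Finset.sum_congr rfl fun j _ => ?_
    ring
  have hint : ∀ i j : Fin d, Integrable fun u : EuclideanSpace ℝ (Fin d) =>
      (gaussK d u * (u i * u j)) * Q (EuclideanSpace.single i 1) (EuclideanSpace.single j 1) := by
    intro i j
    refine (integrable_gaussK_mul (A := 1) (n := 2) (by fun_prop) fun u => ?_).mul_const _
    rw [abs_mul, one_mul, sq]
    exact mul_le_mul (PiLp.norm_apply_le u i) (PiLp.norm_apply_le u j) (abs_nonneg _)
      (norm_nonneg _)
  simp_rw [hexp]
  rw [integral_finsetSum _ fun i _ => integrable_finsetSum _ fun j _ => hint i j]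
  simp_rw [integral_finsetSum _ fun j _ => hint _ j, integral_mul_const,
    integral_gaussK_mul_coord_mul_coord]
  simp [Finset.mul_sum]

end GaussianMoments

section Rescaling

variable {d : ℕ}

lemma integral_comp_inv_smul_sub (g : EuclideanSpace ℝ (Fin d) → ℝ) (p : EuclideanSpace ℝ (Fin d))
    {h : ℝ} (hh : 0 < h) : ∫ x, g (h⁻¹ • (p - x)) = h ^ d * ∫ u, g u := by
  rw [integral_sub_left_eq_self (fun x => g (h⁻¹ • x)) volume p,
    Measure.integral_comp_inv_smul_of_nonneg volume g hh.le]
  simp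

lemma MeasureTheory.Integrable.comp_inv_smul_sub {g : EuclideanSpace ℝ (Fin d) → ℝ}
    (hg : Integrable g) (p : EuclideanSpace ℝ (Fin d)) {h : ℝ} (hh : 0 < h) :
    Integrable fun x => g (h⁻¹ • (p - x)) :=
  ((integrable_comp_smul_iff volume g (inv_ne_zero hh.ne')).2 hg).comp_sub_left p

lemma sub_eq_neg_smul_inv_smul_sub (p x : EuclideanSpace ℝ (Fin d)) {h : ℝ} (hh : 0 < h) :
    x - p = (-h) • (h⁻¹ • (p - x)) := by
  rw [smul_smul, neg_mul, mul_inv_cancel₀ hh.ne', neg_one_smul, neg_sub]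

/-- The rescaled Gaussian integrates a quadratic polynomial without constant term to its
trace. -/
lemma integral_gaussK_mul_quadratic (L : EuclideanSpace ℝ (Fin d) →L[ℝ] ℝ)
    (Q : EuclideanSpace ℝ (Fin d) →L[ℝ] EuclideanSpace ℝ (Fin d) →L[ℝ] ℝ)
    (p : EuclideanSpace ℝ (Fin d)) {h : ℝ} (hh : 0 < h) :
    (Integrable fun x => gaussK d (h⁻¹ • (p - x)) * (L (x - p) + 2⁻¹ * Q (x - p) (x - p))) ∧
    ∫ x, gaussK d (h⁻¹ • (p - x)) * (L (x - p) + 2⁻¹ * Q (x - p) (x - p)) =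
      h ^ (d + 2) * ∑ i, Q (EuclideanSpace.single i 1) (EuclideanSpace.single i 1) := by
  have hL : Integrable fun u => gaussK d u * L u :=
    integrable_gaussK_mul (A := ‖L‖) (n := 1) L.continuous fun u => by
      simpa using L.le_opNorm u
  have hQ : Integrable fun u => gaussK d u * Q u u :=
    integrable_gaussK_mul (A := ‖Q‖) (n := 2) (by fun_prop) fun u => by
      simpa [sq, mul_assoc] using Q.le_opNorm₂ u u
  have hfun : (fun x => gaussK d (h⁻¹ • (p - x)) * (L (x - p) + 2⁻¹ * Q (x - p) (x - p))) =
      fun x => (fun u => -h * (gaussK d u * L u) + h ^ 2 / 2 * (gaussK d u * Q u u))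
        (h⁻¹ • (p - x)) := by
    funext x
    rw [sub_eq_neg_smul_inv_smul_sub p x hh]
    simp only [map_smul, smul_apply, smul_eq_mul]
    ring
  have hint := (hL.const_mul (-h)).add (hQ.const_mul (h ^ 2 / 2))
  rw [hfun]
  refine ⟨hint.comp_inv_smul_sub p hh, ?_⟩
  rw [integral_comp_inv_smul_sub
    (fun u => -h * (gaussK d u * L u) + h ^ 2 / 2 * (gaussK d u * Q u u)) p hh,
    integral_add (hL.const_mul (-h)) (hQ.const_mul (h ^ 2 / 2)), integral_const_mul,
    integral_const_mul, integral_gaussK_mul_clm, integral_gaussK_mul_bilin]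
  ring

/-- Replacing a bounded function by a quadratic polynomial, with a cubic pointwise error, changes
the rescaled Gaussian integral by `O(h ^ (d + 3))`. -/
lemma abs_integral_gaussK_mul_sub_le {N : Set (EuclideanSpace ℝ (Fin d))} (hN : MeasurableSet N)
    {g : EuclideanSpace ℝ (Fin d) → ℝ}
    (hg : AEMeasurable g (volume.restrict N)) {A : ℝ} (hgA : ∀ x ∈ N, |g x| ≤ A)
    (L : EuclideanSpace ℝ (Fin d) →L[ℝ] ℝ)
    (Q : EuclideanSpace ℝ (Fin d) →L[ℝ] EuclideanSpace ℝ (Fin d) →L[ℝ] ℝ)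
    (p : EuclideanSpace ℝ (Fin d)) {M : ℝ}
    (hM : ∀ x, |N.indicator g x - (L (x - p) + 2⁻¹ * Q (x - p) (x - p))| ≤ M * ‖x - p‖ ^ 3)
    {h : ℝ} (hh : 0 < h) :
    |(∫ x in N, gaussK d (h⁻¹ • (p - x)) * g x) -
        h ^ (d + 2) * ∑ i, Q (EuclideanSpace.single i 1) (EuclideanSpace.single i 1)| ≤
      h ^ (d + 3) * (M * ∫ u, gaussK d u * ‖u‖ ^ 3) := by
  obtain ⟨hTint, hT⟩ := integral_gaussK_mul_quadratic L Q p hh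
  have hK : Integrable fun x => gaussK d (h⁻¹ • (p - x)) := by
    have := (integrable_gaussK_mul_norm_pow (d := d) 0).comp_inv_smul_sub p hh
    simpa using this
  have hgint : IntegrableOn (fun x => gaussK d (h⁻¹ • (p - x)) * g x) N := by
    have := hK.integrableOn (s := N)
    refine (Integrable.bdd_mul (c := A) this hg.aestronglyMeasurable ?_).congr
      (ae_of_all _ fun x => mul_comm _ _)
    exact (ae_restrict_iff' hN).2 (ae_of_all _ hgA)
  rw [← hT, ← integral_indicator hN, ← integral_sub (hgint.integrable_indicator hN) hTint]
  have hE : Integrable fun u : EuclideanSpace ℝ (Fin d) =>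
      h ^ 3 * (M * (gaussK d u * ‖u‖ ^ 3)) :=
    ((integrable_gaussK_mul_norm_pow 3).const_mul M).const_mul _
  rw [← Real.norm_eq_abs]
  refine (norm_integral_le_of_norm_le (hE.comp_inv_smul_sub p hh)
    (ae_of_all _ fun x => ?_)).trans_eq ?_
  · have hind : N.indicator (fun x => gaussK d (h⁻¹ • (p - x)) * g x) x =
        gaussK d (h⁻¹ • (p - x)) * N.indicator g x := by
      by_cases hx : x ∈ N <;> simp [hx]
    have hnorm : ‖x - p‖ = h * ‖h⁻¹ • (p - x)‖ := by
      conv_lhs => rw [sub_eq_neg_smul_inv_smul_sub p x hh]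
      rw [norm_smul, norm_neg, Real.norm_of_nonneg hh.le]
    rw [hind, ← mul_sub, norm_mul, Real.norm_of_nonneg (gaussK_nonneg _)]
    calc _ ≤ gaussK d (h⁻¹ • (p - x)) * (M * ‖x - p‖ ^ 3) :=
          mul_le_mul_of_nonneg_left (hM x) (gaussK_nonneg _)
      _ = _ := by rw [hnorm]; ring
  · rw [integral_comp_inv_smul_sub (fun u => h ^ 3 * (M * (gaussK d u * ‖u‖ ^ 3))) p hh,
      integral_const_mul, integral_const_mul]
    ring

end Rescaling

theorem stmt0 (d : ℕ) (hd : 1 ≤ d) (N : Set (EuclideanSpace ℝ (Fin d)))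
    (hNcomp : IsCompact N) (hNpos : 0 < volume N)
    (p : EuclideanSpace ℝ (Fin d)) (hp : p ∈ interior N)
    (U : Set (EuclideanSpace ℝ (Fin d))) (hU : IsOpen U) (hpU : p ∈ U)
    (F : Set (EuclideanSpace ℝ (Fin d) → ℝ)) (B : ℝ)
    (hFsm : ∀ f ∈ F, ContDiffOn ℝ 3 f U)
    (hFmeas : ∀ f ∈ F, AEMeasurable f (volume.restrict N))
    (hFbdd : ∀ f ∈ F, ∀ x ∈ N, |f x| ≤ B)
    (hFder : ∀ f ∈ F, ∀ x ∈ U, ∀ k : ℕ, 1 ≤ k → k ≤ 3 →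
      ‖iteratedFDeriv ℝ k f x‖ ≤ B) :
    ∃ C : ℝ, ∃ h₀ : ℝ, 0 < h₀ ∧ ∀ h : ℝ, 0 < h → h < h₀ → ∀ f ∈ F,
      |avgLap d N f h p - ((volume N).toReal)⁻¹ * eucLap d f p| ≤ C * h := by
  obtain ⟨r, hr, hball⟩ := Metric.isOpen_iff.1 (isOpen_interior.inter hU) p ⟨hp, hpU⟩
  set M : ℝ := B + 2 * B / r ^ 3 + B / r ^ 2 + B / (2 * r) with hM
  refine ⟨((volume N).toReal)⁻¹ * (M * ∫ u, gaussK d u * ‖u‖ ^ 3), 1, one_pos, ?_⟩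
  intro h hh _ f hf
  have hpN : p ∈ N := interior_subset hp
  have hB : 0 ≤ B := (abs_nonneg _).trans (hFbdd f hf p hpN)
  set L := fderiv ℝ f p with hL
  set Q := fderiv ℝ (fderiv ℝ f) p with hQ
  have hLB : ‖L‖ ≤ B := (norm_iteratedFDeriv_one (𝕜 := ℝ) f).symm.trans_le
    (hFder f hf p hpU 1 le_rfl (by norm_num))
  have hQB : ‖Q‖ ≤ B := ((norm_iteratedFDeriv_one (𝕜 := ℝ) (fderiv ℝ f)).symm.trans
    norm_iteratedFDeriv_fderiv).trans_le (hFder f hf p hpU 2 (by norm_num) (by norm_num))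
  have hgA : ∀ x ∈ N, |f x - f p| ≤ 2 * B := fun x hx => by
    have := abs_sub (f x) (f p)
    linarith [hFbdd f hf x hx, hFbdd f hf p hpN]
  have hpt : ∀ x, |N.indicator (fun x => f x - f p) x -
      (L (x - p) + 2⁻¹ * Q (x - p) (x - p))| ≤ M * ‖x - p‖ ^ 3 := by
    intro x
    by_cases hx : x ∈ Metric.ball p r
    · have hxN : x ∈ N := interior_subset (hball hx).1
      rw [Set.indicator_of_mem hxN, ← sub_sub]
      refine (ContDiffOn.norm_taylor_two_sub_le hB ((hFsm f hf).mono fun y hy => (hball hy).2)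
        (fun y hy => hFder f hf y (hball hy).2 3 (by norm_num) le_rfl) hx).trans ?_
      gcongr
      have : 0 ≤ 2 * B / r ^ 3 + B / r ^ 2 + B / (2 * r) := by positivity
      linarith
    · have hrx : 1 ≤ ‖x - p‖ / r := by
        rw [one_le_div hr]
        simpa [dist_eq_norm] using hx
      set t := ‖x - p‖ / r with ht
      have hxt : ‖x - p‖ = r * t := by rw [ht]; field_simp
      have h1 : |N.indicator (fun x => f x - f p) x| ≤ 2 * B := by
        by_cases hxN : x ∈ N
        · simpa [hxN] using hgA x hxN
        · simpa [hxN] using hB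
      have h2 : |L (x - p)| ≤ B * (r * t) := by
        rw [← hxt]
        exact (L.le_opNorm _).trans (by gcongr)
      have h3 : |Q (x - p) (x - p)| ≤ B * (r * t) ^ 2 := by
        rw [← hxt, sq, ← mul_assoc]
        exact (Q.le_opNorm₂ _ _).trans (by gcongr)
      have h4 : M * ‖x - p‖ ^ 3 = B * (r * t) ^ 3 + 2 * B * t ^ 3 + B * (r * t ^ 3) +
          B * (r ^ 2 * t ^ 3) / 2 := by
        rw [hM, hxt]; field_simp
      have h5 : 1 ≤ t ^ 3 := one_le_pow₀ hrx
      have h6 : t ≤ t ^ 3 := le_self_pow₀ hrx (by norm_num)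
      have h7 : t ^ 2 ≤ t ^ 3 := pow_le_pow_right₀ hrx (by norm_num)
      have h8 : 2 * B * 1 ≤ 2 * B * t ^ 3 := by gcongr
      have h9 : B * (r * t) ≤ B * (r * t ^ 3) := by gcongr
      have h10 : B * (r * t) ^ 2 ≤ B * (r ^ 2 * t ^ 3) := by rw [mul_pow]; gcongr
      have h11 : 0 ≤ B * (r * t) ^ 3 := by positivity
      rw [h4, abs_le]
      rw [abs_le] at h1 h2 h3
      constructor <;> linarith
  have key := abs_integral_gaussK_mul_sub_le hNcomp.measurableSet
    ((hFmeas f hf).sub_const (f p)) hgA L Q p hpt hh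
  have hlap : eucLap d f p =
      ∑ i, Q (EuclideanSpace.single i 1) (EuclideanSpace.single i 1) := by
    simp [eucLap, iteratedFDeriv_two_apply, hQ]
  have heq : avgLap d N f h p - ((volume N).toReal)⁻¹ * eucLap d f p =
      ((volume N).toReal)⁻¹ * (h ^ (d + 2))⁻¹ *
        ((∫ x in N, gaussK d (h⁻¹ • (p - x)) * (f x - f p)) - h ^ (d + 2) *
          ∑ i, Q (EuclideanSpace.single i 1) (EuclideanSpace.single i 1)) := by
    rw [avgLap, hlap]
    field_simp
  rw [heq, abs_mul, abs_of_nonneg (by positivity)]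
  calc _ ≤ ((volume N).toReal)⁻¹ * (h ^ (d + 2))⁻¹ *
        (h ^ (d + 3) * (M * ∫ u, gaussK d u * ‖u‖ ^ 3)) := by gcongr
    _ = _ := by
      rw [pow_succ h (d + 2)]
      field_simp
end

section
/- Let m ≥ 1 and K ≥ 0, and let γ : ℝ → ℝ^m be three times continuously differentiable with ‖γ'(t)‖ = 1 for all t, ‖γ''(t)‖ ≤ K for all t, and ‖γ'''(t)‖ ≤ K for all t. Then there exists a constant C < ∞, depending only on K, such that for all t ∈ [0, 1]: 0 ≤ t² − ‖γ(t) − γ(0)‖² ≤ C t⁴. -/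
open Real

/-- A unit-speed curve does not increase distances. -/
lemma norm_sub_le_of_unit_speed {E : Type*} [NormedAddCommGroup E] [NormedSpace ℝ E]
    {γ : ℝ → E} (hγ : Differentiable ℝ γ) (hunit : ∀ t, ‖deriv γ t‖ = 1) (s t : ℝ) :
    ‖γ t - γ s‖ ≤ |t - s| := by
  simpa using convex_univ.norm_image_sub_le_of_norm_deriv_le (fun x _ => hγ x)
    (fun x _ => (hunit x).le) (Set.mem_univ s) (Set.mem_univ t)

/-- The chord of a unit-speed curve with second derivative bounded by `K` falls short of the
arclength by at most `K ^ 2 / 2 * t ^ 3`. -/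
lemma sub_norm_sub_le_of_unit_speed {E : Type*} [NormedAddCommGroup E] [InnerProductSpace ℝ E]
    {γ : ℝ → E} {K : ℝ} (hγ : Differentiable ℝ γ) (hγ' : Differentiable ℝ (deriv γ))
    (hunit : ∀ t, ‖deriv γ t‖ = 1) (hK : ∀ t, ‖deriv (deriv γ) t‖ ≤ K) {t : ℝ} (ht : 0 ≤ t) :
    t - ‖γ t - γ 0‖ ≤ K ^ 2 / 2 * t ^ 3 := by
  set u := deriv γ 0
  have hderiv (s : ℝ) : HasDerivAt (fun s => s - inner ℝ u (γ s - γ 0))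
      (1 - inner ℝ u (deriv γ s)) s := by
    have h := (innerSL ℝ u).hasFDerivAt.comp_hasDerivAt s ((hγ s).hasDerivAt.sub_const (γ 0))
    exact (hasDerivAt_id s).sub h
  have hbound : ∀ s ∈ Set.Icc 0 t, ‖1 - inner ℝ u (deriv γ s)‖ ≤ K ^ 2 / 2 * t ^ 2 := by
    intro s hs
    have hlip : ‖deriv γ s - u‖ ≤ K * |s| := by
      simpa using convex_univ.norm_image_sub_le_of_norm_deriv_le (fun x _ => hγ' x)
        (fun x _ => hK x) (Set.mem_univ 0) (Set.mem_univ s)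
    have hsq : ‖deriv γ s - u‖ ^ 2 = 2 * (1 - inner ℝ u (deriv γ s)) := by
      rw [norm_sub_sq_real, hunit, hunit 0, real_inner_comm]
      ring
    have hle : ‖deriv γ s - u‖ ^ 2 ≤ K ^ 2 * t ^ 2 := by
      calc ‖deriv γ s - u‖ ^ 2 ≤ (K * |s|) ^ 2 := by gcongr
        _ = K ^ 2 * s ^ 2 := by rw [mul_pow, sq_abs]
        _ ≤ K ^ 2 * t ^ 2 := by have := hs.1; have := hs.2; gcongr
    rw [Real.norm_of_nonneg (by nlinarith [sq_nonneg ‖deriv γ s - u‖])]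
    linarith
  have hmv := (convex_Icc 0 t).norm_image_sub_le_of_norm_hasDerivWithin_le
    (fun s _ => (hderiv s).hasDerivWithinAt) hbound
    (Set.left_mem_Icc.2 ht) (Set.right_mem_Icc.2 ht)
  simp only [sub_self, inner_zero_right, sub_zero, Real.norm_eq_abs, abs_of_nonneg ht] at hmv
  have hcs : inner ℝ u (γ t - γ 0) ≤ ‖γ t - γ 0‖ := by
    simpa [u, hunit] using real_inner_le_norm u (γ t - γ 0)
  linarith [le_abs_self (t - inner ℝ u (γ t - γ 0))]

theorem stmt15 (m : ℕ) (hm : 1 ≤ m) (K : ℝ) (hK : 0 ≤ K) :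
    ∃ C : ℝ, ∀ γ : ℝ → EuclideanSpace ℝ (Fin m),
      ContDiff ℝ 3 γ →
      (∀ t : ℝ, ‖deriv γ t‖ = 1) →
      (∀ t : ℝ, ‖deriv (deriv γ) t‖ ≤ K) →
      (∀ t : ℝ, ‖deriv (deriv (deriv γ)) t‖ ≤ K) →
      ∀ t ∈ Set.Icc (0 : ℝ) 1,
        0 ≤ t ^ 2 - ‖γ t - γ 0‖ ^ 2 ∧
        t ^ 2 - ‖γ t - γ 0‖ ^ 2 ≤ C * t ^ 4 := by
  refine ⟨K ^ 2, fun γ hγ hunit hcurv _ t ht => ?_⟩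
  have hd : Differentiable ℝ γ := hγ.differentiable (by norm_num)
  have hd' : Differentiable ℝ (deriv γ) := by
    simpa using hγ.differentiable_iteratedDeriv 1 (by norm_num)
  have hle : ‖γ t - γ 0‖ ≤ t := by
    simpa [abs_of_nonneg ht.1] using norm_sub_le_of_unit_speed hd hunit 0 t
  have hge := sub_norm_sub_le_of_unit_speed hd hd' hunit hcurv ht.1
  have hnn := norm_nonneg (γ t - γ 0)
  constructor
  · nlinarith
  · calc t ^ 2 - ‖γ t - γ 0‖ ^ 2 = (t - ‖γ t - γ 0‖) * (t + ‖γ t - γ 0‖) := by ring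
      _ ≤ (K ^ 2 / 2 * t ^ 3) * (t + t) := by
        have := ht.1
        gcongr
      _ = K ^ 2 * t ^ 4 := by ring
end

section
/- Let f : ℝ^d → ℝ satisfy |f(x) − f(y)| ≤ B‖x − y‖ for all x, y ∈ ℝ^d, where B ≥ 0. Then for every q ∈ ℝ^d and every h > 0, E[K((q − X)/h)² (f(X) − f(q))²] ≤ d B² h^{d+2} / (2^d (2π)^{d/2} |N|). -/
open MeasureTheory Real Filter
open scoped Topology

/-- The second moment of the Gaussian `exp (-b‖v‖²)` on a finite-dimensional inner product space. -/
theorem integral_norm_sq_mul_rexp_neg_mul_sq_norm {V : Type*} [NormedAddCommGroup V]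
    [InnerProductSpace ℝ V] [FiniteDimensional ℝ V] [Nontrivial V] [MeasurableSpace V]
    [BorelSpace V] {b : ℝ} (hb : 0 < b) :
    ∫ v : V, ‖v‖ ^ 2 * rexp (-b * ‖v‖ ^ 2) =
      Module.finrank ℝ V / (2 * b) * (π / b) ^ (Module.finrank ℝ V / 2 : ℝ) := by
  rw [← GaussianFourier.integral_rexp_neg_mul_sq_norm hb,
    integral_fun_norm_addHaar volume (fun y => y ^ 2 * rexp (-b * y ^ 2)),
    integral_fun_norm_addHaar volume (fun y => rexp (-b * y ^ 2))]
  set n := Module.finrank ℝ V with hn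
  have hnpos : 0 < n := Module.finrank_pos
  have hn1 : (1 : ℝ) ≤ n := by exact_mod_cast hnpos
  have radial_two : ∫ y in Set.Ioi (0 : ℝ), y ^ (n - 1) • (y ^ 2 * rexp (-b * y ^ 2)) =
      b ^ (-(n / 2 + 1) : ℝ) * (1 / 2) * Gamma (n / 2 + 1) := by
    have key := integral_rpow_mul_exp_neg_mul_rpow (p := 2) (q := n + 1) two_pos
      (by linarith) hb
    rw [show -((n : ℝ) + 1 + 1) / 2 = -(n / 2 + 1) by ring,
      show ((n : ℝ) + 1 + 1) / 2 = n / 2 + 1 by ring] at key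
    rw [← key]
    refine setIntegral_congr_fun measurableSet_Ioi fun y _ => ?_
    simp only [smul_eq_mul, rpow_two]
    rw [← mul_assoc, ← pow_add, show n - 1 + 2 = n + 1 by lia]
    norm_cast
  have radial_zero : ∫ y in Set.Ioi (0 : ℝ), y ^ (n - 1) • rexp (-b * y ^ 2) =
      b ^ (-(n / 2) : ℝ) * (1 / 2) * Gamma (n / 2) := by
    have key := integral_rpow_mul_exp_neg_mul_rpow (p := 2) (q := ((n - 1 : ℕ) : ℝ)) two_pos
      (by linarith [Nat.cast_nonneg (α := ℝ) (n - 1)]) hb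
    rw [Nat.cast_sub hnpos, Nat.cast_one, show -((n : ℝ) - 1 + 1) / 2 = -(n / 2) by ring,
      show ((n : ℝ) - 1 + 1) / 2 = n / 2 by ring] at key
    rw [← key]
    refine setIntegral_congr_fun measurableSet_Ioi fun y _ => ?_
    simp only [smul_eq_mul, rpow_two]
    rw [← rpow_natCast, Nat.cast_sub hnpos, Nat.cast_one]
  rw [radial_two, radial_zero, Gamma_add_one (by positivity), neg_add, rpow_add hb,
    rpow_neg_one]
  simp only [nsmul_eq_mul, smul_eq_mul]
  field_simp

theorem integrable_norm_sq_mul_rexp_neg_mul_sq_norm {V : Type*} [NormedAddCommGroup V]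
    [InnerProductSpace ℝ V] [FiniteDimensional ℝ V] [Nontrivial V] [MeasurableSpace V]
    [BorelSpace V] {b : ℝ} (hb : 0 < b) :
    Integrable fun v : V => ‖v‖ ^ 2 * rexp (-b * ‖v‖ ^ 2) := by
  refine .of_integral_ne_zero ?_
  have : 0 < Module.finrank ℝ V := Module.finrank_pos
  rw [integral_norm_sq_mul_rexp_neg_mul_sq_norm hb]
  positivity

theorem gaussK_sq (d : ℕ) (u : EuclideanSpace ℝ (Fin d)) :
    gaussK d u ^ 2 = ((4 * π) ^ d)⁻¹ * rexp (-‖u‖ ^ 2 / 2) := by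
  rw [gaussK, mul_pow, ← rpow_mul_natCast (by positivity), ← Real.exp_nat_mul,
    ← rpow_natCast (4 * π) d, ← rpow_neg (by positivity)]
  congr 2 <;> push_cast <;> ring

theorem stmt16 (d : ℕ) (hd : 1 ≤ d) (N : Set (EuclideanSpace ℝ (Fin d)))
    (hNcomp : IsCompact N) (hNpos : 0 < volume N)
    {Ω : Type*} [MeasurableSpace Ω] (P : Measure Ω) [IsProbabilityMeasure P]
    (X : Ω → EuclideanSpace ℝ (Fin d)) (hXmeas : Measurable X)
    (hXlaw : Measure.map X P = (volume N)⁻¹ • volume.restrict N)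
    (f : EuclideanSpace ℝ (Fin d) → ℝ) (B : ℝ) (hB : 0 ≤ B)
    (hLip : ∀ x y : EuclideanSpace ℝ (Fin d), |f x - f y| ≤ B * ‖x - y‖)
    (q : EuclideanSpace ℝ (Fin d)) (h : ℝ) (hh : 0 < h) :
    (∫ ω, gaussK d (h⁻¹ • (q - X ω)) ^ 2 * (f (X ω) - f q) ^ 2 ∂P) ≤
      d * B ^ 2 * h ^ (d + 2) /
        (2 ^ d * (2 * π) ^ ((d : ℝ) / 2) * (volume N).toReal) := by
  have : Nonempty (Fin d) := ⟨⟨0, hd⟩⟩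
  set b : ℝ := 1 / (2 * h ^ 2) with hb
  have hbpos : 0 < b := by positivity
  set g : EuclideanSpace ℝ (Fin d) → ℝ := fun x =>
    ((4 * π) ^ d)⁻¹ * B ^ 2 * (‖x - q‖ ^ 2 * rexp (-b * ‖x - q‖ ^ 2)) with hg
  have hgint : Integrable g :=
    ((integrable_norm_sq_mul_rexp_neg_mul_sq_norm hbpos).comp_sub_right q).const_mul _
  have hgnonneg : ∀ x, 0 ≤ g x := fun x => by positivity
  have hgmeas : AEStronglyMeasurable g (Measure.map X P) :=
    Continuous.aestronglyMeasurable (by fun_prop)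
  have hglaw : Integrable g (Measure.map X P) := by
    rw [hXlaw]
    exact hgint.integrableOn.smul_measure (ENNReal.inv_ne_top.2 hNpos.ne')
  have hbound : ∀ x, gaussK d (h⁻¹ • (q - x)) ^ 2 * (f x - f q) ^ 2 ≤ g x := fun x => by
    have hsq : (f x - f q) ^ 2 ≤ B ^ 2 * ‖x - q‖ ^ 2 := by
      rw [← mul_pow, ← sq_abs]
      exact pow_le_pow_left₀ (abs_nonneg _) (hLip x q) 2
    have hexp : -‖h⁻¹ • (q - x)‖ ^ 2 / 2 = -b * ‖x - q‖ ^ 2 := by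
      rw [norm_smul, norm_sub_rev, norm_inv, Real.norm_of_nonneg hh.le, hb]
      field_simp
    rw [gaussK_sq, hexp]
    calc _ ≤ ((4 * π) ^ d)⁻¹ * rexp (-b * ‖x - q‖ ^ 2) * (B ^ 2 * ‖x - q‖ ^ 2) := by gcongr
      _ = g x := by simp only [hg]; ring
  have hNfin : 0 < (volume N).toReal := ENNReal.toReal_pos hNpos.ne' hNcomp.measure_lt_top.ne
  have hpow : (π / b) ^ ((d : ℝ) / 2) = (2 * π) ^ ((d : ℝ) / 2) * h ^ d := by
    rw [show π / b = 2 * π * h ^ 2 by rw [hb]; field_simp,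
      mul_rpow (by positivity) (by positivity), ← rpow_natCast h 2, ← rpow_mul hh.le,
      ← rpow_natCast h d]
    congr 2
    push_cast
    ring
  have hpi : ((2 * π) ^ ((d : ℝ) / 2)) ^ 2 = (2 * π) ^ d := by
    rw [← rpow_mul_natCast (by positivity), ← rpow_natCast]
    congr 1
    push_cast
    ring
  calc _ ≤ ∫ ω, g (X ω) ∂P :=
        integral_mono_of_nonneg (.of_forall fun ω => by positivity)
          (hglaw.comp_measurable hXmeas) (.of_forall fun ω => hbound (X ω))
    _ = (volume N).toReal⁻¹ * ∫ x in N, g x := by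
        rw [← integral_map hXmeas.aemeasurable hgmeas, hXlaw, integral_smul_measure,
          ENNReal.toReal_inv, smul_eq_mul]
    _ ≤ (volume N).toReal⁻¹ * ∫ x, g x := by
        gcongr ?_ * ?_
        exact setIntegral_le_integral hgint (.of_forall hgnonneg)
    _ = (volume N).toReal⁻¹ * (((4 * π) ^ d)⁻¹ * B ^ 2 *
          (d / (2 * b) * ((2 * π) ^ ((d : ℝ) / 2) * h ^ d))) := by
        rw [integral_const_mul, integral_sub_right_eq_self
          (fun x : EuclideanSpace ℝ (Fin d) => ‖x‖ ^ 2 * rexp (-b * ‖x‖ ^ 2)) q,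
          integral_norm_sq_mul_rexp_neg_mul_sq_norm hbpos, finrank_euclideanSpace_fin, hpow]
    _ = _ := by
        rw [show (4 * π) ^ d = 2 ^ d * ((2 * π) ^ ((d : ℝ) / 2)) ^ 2 by
          rw [hpi, ← mul_pow]; ring, hb]
        field_simp
        ring
end
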